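/- For the scalar case: if α > 0, 0 < α ≤ 1, λ ∈ ℂ, then y(t) = E_{α,1}(λ t^α) satisfies the Volterra integral equation y(t) = 1 + (λ/Γ(α)) ∫_0^t (t−τ)^{α−1} y(τ) dτ for all t ≥ 0. -/

import Mathlib

/-- The Mittag-Leffler function `E_{α,β}(z) = ∑_{j=0}^∞ z^j / Γ(αj+β)`. -/
noncomputable def mittagLeffler (α β : ℝ) (z : ℂ) : ℂ :=
  ∑' j : ℕ, z ^ j / Complex.Gamma ((α * j + β : ℝ) : ℂ)

/-- Elementary lower bound for Gamma. -/
theorem ml_gamma_lower (s M : ℝ) (hs : 0 ≤ s) (hM : 0 < M) :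
    M ^ s * Real.exp (-M) ≤ Real.Gamma (s + 1) := by
  rw [Real.Gamma_eq_integral (by linarith), ← integral_exp_neg_Ioi M,
    ← MeasureTheory.integral_const_mul]
  have hI := Real.GammaIntegral_convergent (s := s + 1) (by linarith)
  have hsub : Set.Ioi M ⊆ Set.Ioi (0 : ℝ) := Set.Ioi_subset_Ioi hM.le
  refine le_trans (MeasureTheory.setIntegral_mono_on (g := fun x => Real.exp (-x) * x ^ (s + 1 - 1))
    ?_ (hI.mono_set hsub) measurableSet_Ioi ?_)
    (MeasureTheory.setIntegral_mono_set hI ?_ (Filter.Eventually.of_forall hsub))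
  · exact (integrableOn_exp_neg_Ioi M).const_mul _
  · intro x hx
    have hx' : M < x := hx
    rw [mul_comm, add_sub_cancel_right]
    gcongr
  · filter_upwards [MeasureTheory.ae_restrict_mem measurableSet_Ioi] with x hx
    have : (0 : ℝ) < x := hx
    simp only [Pi.zero_apply]
    positivity

theorem ml_summable (α : ℝ) (hα : 0 < α) (R : ℝ) (hR : 0 ≤ R) :
    Summable (fun j : ℕ => R ^ j / Real.Gamma (α * j + 1)) := by
  set M : ℝ := (R + 1) ^ (1 / α) with hMdef
  have hM : 0 < M := by positivity
  have hMα : M ^ α = R + 1 := by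
    rw [hMdef, ← Real.rpow_mul (by linarith), one_div_mul_cancel hα.ne', Real.rpow_one]
  have hgeo : Summable (fun j : ℕ => Real.exp M * (R / (R + 1)) ^ j) := by
    apply Summable.mul_left
    apply summable_geometric_of_lt_one (by positivity)
    rw [div_lt_one (by linarith)]
    linarith
  refine Summable.of_nonneg_of_le (fun j => ?_) (fun j => ?_) hgeo
  · have : 0 < Real.Gamma (α * j + 1) := Real.Gamma_pos_of_pos (by positivity)
    positivity
  · have h := ml_gamma_lower (α * j) M (by positivity) hM
    rw [Real.rpow_mul hM.le, hMα, Real.rpow_natCast, Real.exp_neg] at h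
    have hp : 0 < (R + 1) ^ j * (Real.exp M)⁻¹ := by positivity
    calc R ^ j / Real.Gamma (α * j + 1) ≤ R ^ j / ((R + 1) ^ j * (Real.exp M)⁻¹) := by gcongr
      _ = _ := by
        rw [div_pow]
        field_simp

theorem ml_norm_term (α : ℝ) (hα : 0 < α) (z : ℂ) (j : ℕ) :
    ‖z ^ j / Complex.Gamma ((α * j + 1 : ℝ) : ℂ)‖ = ‖z‖ ^ j / Real.Gamma (α * j + 1) := by
  have : 0 < Real.Gamma (α * j + 1) := Real.Gamma_pos_of_pos (by positivity)
  rw [Complex.Gamma_ofReal, norm_div, norm_pow, Complex.norm_real, Real.norm_of_nonneg this.le]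

theorem ml_summable_complex (α : ℝ) (hα : 0 < α) (z : ℂ) :
    Summable (fun j : ℕ => z ^ j / Complex.Gamma ((α * j + 1 : ℝ) : ℂ)) := by
  apply Summable.of_norm
  simp only [ml_norm_term α hα]
  exact ml_summable α hα _ (norm_nonneg z)

theorem ml_term_integral (α : ℝ) (hα : 0 < α) (lam : ℂ) (t : ℝ) (ht : 0 < t) (j : ℕ) :
    (lam / Complex.Gamma ((α : ℝ) : ℂ)) *
      ∫ τ in (0 : ℝ)..t, ((((t - τ) ^ (α - 1) : ℝ)) : ℂ) *
        ((lam * ((τ ^ α : ℝ) : ℂ)) ^ j / Complex.Gamma ((α * j + 1 : ℝ) : ℂ)) =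
    (lam * ((t ^ α : ℝ) : ℂ)) ^ (j + 1) /
      Complex.Gamma ((α * ((j + 1 : ℕ) : ℝ) + 1 : ℝ) : ℂ) := by
  have hs : 0 < ((α * j + 1 : ℝ) : ℂ).re := by rw [Complex.ofReal_re]; positivity
  have ha : 0 < ((α : ℝ) : ℂ).re := by rwa [Complex.ofReal_re]
  have h1 : ∫ τ in (0 : ℝ)..t, ((((t - τ) ^ (α - 1) : ℝ)) : ℂ) *
        ((lam * ((τ ^ α : ℝ) : ℂ)) ^ j / Complex.Gamma ((α * j + 1 : ℝ) : ℂ)) =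
      ∫ τ in (0 : ℝ)..t, (lam ^ j / Complex.Gamma ((α * j + 1 : ℝ) : ℂ)) *
        ((τ : ℂ) ^ (((α * j + 1 : ℝ) : ℂ) - 1) * ((t : ℂ) - τ) ^ ((α : ℂ) - 1)) := by
    apply intervalIntegral.integral_congr
    intro τ hτ
    rw [Set.uIcc_of_le ht.le] at hτ
    have e1 : (τ : ℂ) ^ (((α * j + 1 : ℝ) : ℂ) - 1) = ((τ ^ α : ℝ) : ℂ) ^ j := by
      rw [← Complex.ofReal_pow, ← Real.rpow_mul_natCast hτ.1, Complex.ofReal_cpow hτ.1]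
      congr 1
      push_cast
      ring
    have e2 : ((t : ℂ) - τ) ^ ((α : ℂ) - 1) = (((t - τ) ^ (α - 1) : ℝ) : ℂ) := by
      rw [Complex.ofReal_cpow (by linarith [hτ.2])]
      push_cast
      rfl
    simp only [e1, e2]
    ring
  have hB := Complex.Gamma_mul_Gamma_eq_betaIntegral hs ha
  have g1 : Complex.Gamma ((α * j + 1 : ℝ) : ℂ) ≠ 0 := Complex.Gamma_ne_zero_of_re_pos hs
  have g2 : Complex.Gamma ((α : ℝ) : ℂ) ≠ 0 := Complex.Gamma_ne_zero_of_re_pos ha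
  have e3 : ((α * ((j + 1 : ℕ) : ℝ) + 1 : ℝ) : ℂ) = ((α * j + 1 : ℝ) : ℂ) + (α : ℂ) := by
    push_cast
    ring
  have g3 : Complex.Gamma (((α * j + 1 : ℝ) : ℂ) + (α : ℂ)) ≠ 0 :=
    Complex.Gamma_ne_zero_of_re_pos (by rw [Complex.add_re]; linarith)
  have e4 : (t : ℂ) ^ (((α * j + 1 : ℝ) : ℂ) + (α : ℂ) - 1) = ((t ^ α : ℝ) : ℂ) ^ (j + 1) := by
    rw [← Complex.ofReal_pow, ← Real.rpow_mul_natCast ht.le, Complex.ofReal_cpow ht.le]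
    congr 1
    push_cast
    ring
  rw [h1, intervalIntegral.integral_const_mul, Complex.betaIntegral_scaled _ _ ht, e3, e4]
  rw [mul_pow, pow_succ lam j]
  field_simp
  rw [mul_assoc, mul_comm (Complex.betaIntegral _ _), ← hB]
  ring

/-- For `0 < α ≤ 1` and `λ ∈ ℂ`, the function `y(t) = E_{α,1}(λ t^α)` satisfies the
Volterra integral equation `y(t) = 1 + (λ/Γ(α)) ∫_0^t (t-τ)^{α-1} y(τ) dτ` for `t ≥ 0`. -/
theorem mittagLeffler_volterra (α : ℝ) (hα0 : 0 < α) (hα1 : α ≤ 1) (lam : ℂ) :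
    ∀ t : ℝ, 0 ≤ t →
      mittagLeffler α 1 (lam * ((t ^ α : ℝ) : ℂ)) =
        1 + (lam / Complex.Gamma ((α : ℝ) : ℂ)) *
          ∫ τ in (0 : ℝ)..t, ((((t - τ) ^ (α - 1) : ℝ)) : ℂ) *
            mittagLeffler α 1 (lam * ((τ ^ α : ℝ) : ℂ)) := by
  intro t ht
  have h0 : mittagLeffler α 1 (lam * ((t ^ α : ℝ) : ℂ)) =
      1 + ∑' j : ℕ, (lam * ((t ^ α : ℝ) : ℂ)) ^ (j + 1) /
        Complex.Gamma ((α * ((j + 1 : ℕ) : ℝ) + 1 : ℝ) : ℂ) := by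
    unfold mittagLeffler
    rw [(ml_summable_complex α hα0 _).tsum_eq_zero_add]
    simp
  rcases ht.eq_or_lt with rfl | htpos
  · rw [h0]
    simp [Real.zero_rpow hα0.ne']
  rw [h0]
  congr 1
  have hker : IntervalIntegrable (fun τ : ℝ => (t - τ) ^ (α - 1)) MeasureTheory.volume 0 t := by
    have := (intervalIntegral.intervalIntegrable_rpow' (a := 0) (b := t) (r := α - 1)
      (by linarith)).comp_sub_left t
    simpa using this.symm
  have hsum := ml_summable α hα0 (‖lam‖ * t ^ α) (by positivity)
  have key := intervalIntegral.hasSum_integral_of_dominated_convergence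
    (μ := MeasureTheory.volume) (a := 0) (b := t)
    (F := fun (j : ℕ) (τ : ℝ) => ((((t - τ) ^ (α - 1) : ℝ)) : ℂ) *
        ((lam * ((τ ^ α : ℝ) : ℂ)) ^ j / Complex.Gamma ((α * j + 1 : ℝ) : ℂ)))
    (f := fun τ => ((((t - τ) ^ (α - 1) : ℝ)) : ℂ) *
            mittagLeffler α 1 (lam * ((τ ^ α : ℝ) : ℂ)))
    (fun j τ => (t - τ) ^ (α - 1) * ((‖lam‖ * t ^ α) ^ j / Real.Gamma (α * j + 1)))
    (fun j => by
      apply Measurable.aestronglyMeasurable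
      fun_prop)
    (fun j => by
      filter_upwards with τ hτ
      rw [Set.uIoc_of_le ht] at hτ
      have hg : 0 < Real.Gamma (α * j + 1) := Real.Gamma_pos_of_pos (by positivity)
      have hk : 0 ≤ (t - τ) ^ (α - 1) := Real.rpow_nonneg (by linarith [hτ.2]) _
      have hτ0 : 0 ≤ τ := hτ.1.le
      have hτ2 : τ ≤ t := hτ.2
      rw [norm_mul, ml_norm_term α hα0, norm_mul, Complex.norm_real, Complex.norm_real,
        Real.norm_of_nonneg hk, Real.norm_of_nonneg (Real.rpow_nonneg hτ0 _)]
      gcongr)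
    (by
      filter_upwards with τ hτ
      exact hsum.mul_left _)
    (by
      simp only [tsum_mul_left]
      exact hker.mul_const _)
    (by
      filter_upwards with τ hτ
      exact (ml_summable_complex α hα0 _).hasSum.mul_left _)
  have key2 := key.mul_left (lam / Complex.Gamma ((α : ℝ) : ℂ))
  rw [← key2.tsum_eq]
  exact tsum_congr fun j => (ml_term_integral α hα0 lam t htpos j).symm
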